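/- Let k be a field of characteristic 3 and let A = k[X, Y]/(Y² − X³), with x and y denoting the images of X and Y. Then: (a) there is a (unique) k-linear derivation D₀ : A → A with D₀(x) = 1 and D₀(y) = 0 (induced by ∂/∂X, which is well defined on A since ∂(Y² − X³)/∂X = −3X² = 0 in characteristic 3); (b) every k-linear derivation D : A → A satisfies D(y) = 0 and D = D(x)·D₀; consequently the A-module of k-linear derivations of A is free of rank one, generated by D₀. -/

import Mathlib

set_option synthInstance.maxHeartbeats 400000
set_option maxHeartbeats 1000000

noncomputable section

open MvPolynomial

/-- The affine coordinate ring `A = k[X,Y]/(Y² − X³)` of the cuspidal cubic. -/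
abbrev CuspAlg (k : Type*) [Field k] :=
  MvPolynomial (Fin 2) k ⧸
    Ideal.span {(X 1 ^ 2 - X 0 ^ 3 : MvPolynomial (Fin 2) k)}

/-- The image `x` of `X` in `A`. -/
def cuspX (k : Type*) [Field k] : CuspAlg k :=
  Ideal.Quotient.mk (Ideal.span {(X 1 ^ 2 - X 0 ^ 3 : MvPolynomial (Fin 2) k)}) (X 0)

/-- The image `y` of `Y` in `A`. -/
def cuspY (k : Type*) [Field k] : CuspAlg k :=
  Ideal.Quotient.mk (Ideal.span {(X 1 ^ 2 - X 0 ^ 3 : MvPolynomial (Fin 2) k)}) (X 1)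

theorem cuspY_sq (k : Type*) [Field k] : cuspY k ^ 2 = cuspX k ^ 3 := by
  simp only [cuspX, cuspY, ← map_pow]
  exact Ideal.Quotient.eq.mpr (Ideal.mem_span_singleton_self _)

theorem CuspAlg.three_eq_zero (k : Type*) [Field k] [CharP k 3] : (3 : CuspAlg k) = 0 := by
  have h : (3 : k) = 0 := CharP.cast_eq_zero k 3
  rw [← map_ofNat (algebraMap k (CuspAlg k)) 3, ← map_zero (algebraMap k (CuspAlg k))]
  exact congrArg _ h

/-- `y` is not a zero divisor in `A`. -/
theorem eq_zero_of_cuspY_mul_eq_zero {k : Type*} [Field k] {a : CuspAlg k}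
    (h : cuspY k * a = 0) : a = 0 := by
  obtain ⟨f, rfl⟩ := Ideal.Quotient.mk_surjective a
  rw [cuspY, ← map_mul, Ideal.Quotient.eq_zero_iff_mem, Ideal.mem_span_singleton] at h
  rw [Ideal.Quotient.eq_zero_iff_mem, Ideal.mem_span_singleton]
  obtain ⟨g, hg⟩ := h
  have hp : Prime (X 1 : MvPolynomial (Fin 2) k) := X_prime
  have hd : (X 1 : MvPolynomial (Fin 2) k) ∣ X 0 ^ 3 * g :=
    ⟨X 1 * g - f, by linear_combination hg⟩
  rcases hp.dvd_or_dvd hd with h0 | ⟨q, rfl⟩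
  · exact absurd (X_dvd_X.mp (hp.dvd_of_dvd_pow h0)) (by decide)
  · exact ⟨q, mul_left_cancel₀ hp.ne_zero (by linear_combination hg)⟩

/-- Derivations of `A` are determined by their values on `x` and `y`. -/
theorem CuspAlg.derivation_ext {k : Type*} [Field k]
    {D₁ D₂ : Derivation k (CuspAlg k) (CuspAlg k)}
    (hx : D₁ (cuspX k) = D₂ (cuspX k)) (hy : D₁ (cuspY k) = D₂ (cuspY k)) : D₁ = D₂ := by
  have h : D₁.compAlgebraMap (MvPolynomial (Fin 2) k) =
      D₂.compAlgebraMap (MvPolynomial (Fin 2) k) := by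
    refine MvPolynomial.derivation_ext fun i => ?_
    fin_cases i
    · exact hx
    · exact hy
  ext a
  obtain ⟨f, rfl⟩ := Ideal.Quotient.mk_surjective a
  exact congrArg (fun D => D f) h

theorem mk_pderiv_eq_zero {k : Type*} [Field k] [CharP k 3] (f : MvPolynomial (Fin 2) k)
    (hf : Ideal.Quotient.mkₐ k
      (Ideal.span {(X 1 ^ 2 - X 0 ^ 3 : MvPolynomial (Fin 2) k)}) f = 0) :
    Ideal.Quotient.mkₐ k
      (Ideal.span {(X 1 ^ 2 - X 0 ^ 3 : MvPolynomial (Fin 2) k)}) (pderiv 0 f) = 0 := by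
  rw [Ideal.Quotient.mkₐ_eq_mk, Ideal.Quotient.eq_zero_iff_mem, Ideal.mem_span_singleton] at hf ⊢
  obtain ⟨g, rfl⟩ := hf
  have h3 : (3 : MvPolynomial (Fin 2) k) = 0 := by
    rw [← map_ofNat C 3, ← map_zero C]
    exact congrArg C (CharP.cast_eq_zero k 3)
  refine ⟨pderiv 0 g, ?_⟩
  have hX : pderiv (0 : Fin 2) (X 1 : MvPolynomial (Fin 2) k) = 0 :=
    pderiv_X_of_ne (by decide)
  simp only [Derivation.leibniz, map_sub, Derivation.leibniz_pow, hX, pderiv_X_self, smul_eq_mul,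
    nsmul_eq_mul]
  push_cast
  linear_combination (-g * X 0 ^ 2) * h3

/-- The derivation of `A` induced by `∂/∂X`. -/
def cuspDerivation (k : Type*) [Field k] [CharP k 3] : Derivation k (CuspAlg k) (CuspAlg k) :=
  Derivation.liftOfSurjective (f := Ideal.Quotient.mkₐ k
    (Ideal.span {(X 1 ^ 2 - X 0 ^ 3 : MvPolynomial (Fin 2) k)}))
    (Ideal.Quotient.mkₐ_surjective k _) (d := pderiv 0) mk_pderiv_eq_zero

theorem cuspDerivation_mk {k : Type*} [Field k] [CharP k 3] (f : MvPolynomial (Fin 2) k) :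
    cuspDerivation k (Ideal.Quotient.mk _ f) = Ideal.Quotient.mk _ (pderiv 0 f) :=
  Derivation.liftOfSurjective_apply (Ideal.Quotient.mkₐ_surjective k _) mk_pderiv_eq_zero f

theorem cuspDerivation_cuspX (k : Type*) [Field k] [CharP k 3] :
    cuspDerivation k (cuspX k) = 1 := by
  rw [cuspX, cuspDerivation_mk, pderiv_X_self, map_one]

theorem cuspDerivation_cuspY (k : Type*) [Field k] [CharP k 3] :
    cuspDerivation k (cuspY k) = 0 := by
  rw [cuspY, cuspDerivation_mk, pderiv_X_of_ne (by decide), map_zero]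

theorem derivation_cuspY {k : Type*} [Field k] [CharP k 3]
    (D : Derivation k (CuspAlg k) (CuspAlg k)) : D (cuspY k) = 0 := by
  have h := congrArg D (cuspY_sq k)
  simp only [Derivation.leibniz_pow, smul_eq_mul, nsmul_eq_mul] at h
  push_cast at h
  have h3 := CuspAlg.three_eq_zero k
  refine eq_zero_of_cuspY_mul_eq_zero ?_
  linear_combination -h + (cuspY k * D (cuspY k) - cuspX k ^ 2 * D (cuspX k)) * h3

/-- over a field of characteristic `3`, the cuspidal cubic
`A = k[X,Y]/(Y² − X³)` has a unique `k`-derivation `D₀` with `D₀(x) = 1`, `D₀(y) = 0`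
(induced by `∂/∂X`), and every `k`-derivation `D : A → A` satisfies `D(y) = 0` and
`D = D(x) • D₀`; so the `A`-module of `k`-derivations of `A` is free of rank one on `D₀`. -/
theorem stmt12 (k : Type*) [Field k] [CharP k 3] :
    ∃ D0 : Derivation k (CuspAlg k) (CuspAlg k),
      (D0 (cuspX k) = 1 ∧ D0 (cuspY k) = 0) ∧
      (∀ D0' : Derivation k (CuspAlg k) (CuspAlg k),
        D0' (cuspX k) = 1 ∧ D0' (cuspY k) = 0 → D0' = D0) ∧
      (∀ D : Derivation k (CuspAlg k) (CuspAlg k),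
        D (cuspY k) = 0 ∧ D = D (cuspX k) • D0) := by
  refine ⟨cuspDerivation k, ⟨cuspDerivation_cuspX k, cuspDerivation_cuspY k⟩, ?_, fun D => ?_⟩
  · rintro D' ⟨hx, hy⟩
    exact CuspAlg.derivation_ext (hx.trans (cuspDerivation_cuspX k).symm)
      (hy.trans (cuspDerivation_cuspY k).symm)
  · refine ⟨derivation_cuspY D, CuspAlg.derivation_ext ?_ ?_⟩
    · rw [Derivation.smul_apply, cuspDerivation_cuspX, smul_eq_mul, mul_one]
    · rw [Derivation.smul_apply, cuspDerivation_cuspY, smul_zero, derivation_cuspY]
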